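/- Every Verma module Δ_c(τ) has a unique simple quotient L_c(τ), and the map τ ↦ L_c(τ) is a bijection between Irr(W) and the set of isomorphism classes of simple objects of O_c(W). -/

import Mathlib

/-! Core definitions: complex reflection groups, rational Cherednik algebras,
and their categories 𝒪. -/

noncomputable section

open Module Function

/-- A (complex) reflection: a linear automorphism `g` with `rank (g - 1) = 1`. -/
def IsComplexReflection {V : Type} [AddCommGroup V] [Module ℂ V]
    (g : V ≃ₗ[ℂ] V) : Prop :=
  Module.finrank ℂ (LinearMap.range (g.toLinearMap - LinearMap.id)) = 1

variable (V : Type) [AddCommGroup V] [Module ℂ V] [FiniteDimensional ℂ V]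

/-- A finite complex reflection group on a finite dimensional complex vector
space `V`: a finite subgroup of `GL(V)` generated by its reflections. -/
structure CRG where
  W : Subgroup (V ≃ₗ[ℂ] V)
  finite : Finite W
  gen : Subgroup.closure {g : V ≃ₗ[ℂ] V | g ∈ W ∧ IsComplexReflection g} = W

variable {V}

/-- The set `S` of reflections in `W`. -/
def CRG.Refl (G : CRG V) : Type :=
  {s : G.W // IsComplexReflection (s : V ≃ₗ[ℂ] V)}

instance (G : CRG V) : CoeOut G.Refl G.W := ⟨fun s => s.1⟩

/-- Conjugation invariance of a parameter `c : S → ℂ`. -/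
def IsConjInvariant {G : CRG V} (c : G.Refl → ℂ) : Prop :=
  ∀ s t : G.Refl, (∃ g : G.W, t.1 = g * s.1 * g⁻¹) → c t = c s

/-- For each reflection `s`: eigenvectors `α_s ∈ h*`, `α_s^∨ ∈ h` for `s` with
eigenvalue different from `1`, normalized by `⟨α_s, α_s^∨⟩ = 2`; `lam s` is the
eigenvalue of `s` on `h*` different from `1`. -/
structure ReflData (G : CRG V) where
  α : G.Refl → Module.Dual ℂ V
  αv : G.Refl → V
  lam : G.Refl → ℂ
  lam_ne_one : ∀ s, lam s ≠ 1
  α_ne : ∀ s, α s ≠ 0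
  αv_ne : ∀ s, αv s ≠ 0
  eig_α : ∀ (s : G.Refl) (v : V),
    α s (((s.1 : V ≃ₗ[ℂ] V)).symm v) = lam s * α s v
  eig_αv : ∀ s : G.Refl, ∃ μ : ℂ, μ ≠ 1 ∧ ((s.1 : V ≃ₗ[ℂ] V)) (αv s) = μ • αv s
  pairing : ∀ s, α s (αv s) = 2

/-- The rational Cherednik algebra `H_c(W)`: the quotient of `T(h ⊕ h*)#W` by
the commutation relations, presented via its universal property. -/
structure RCA (G : CRG V) (D : ReflData G) (c : G.Refl → ℂ) where
  H : Type
  [ring : Ring H]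
  [alg : Algebra ℂ H]
  x : Module.Dual ℂ V →ₗ[ℂ] H
  y : V →ₗ[ℂ] H
  w : G.W →* H
  comm_x : ∀ a b, x a * x b = x b * x a
  comm_y : ∀ u v, y u * y v = y v * y u
  w_x : ∀ (g : G.W) (a : Module.Dual ℂ V),
    w g * x a = x (a ∘ₗ (((g⁻¹ : G.W) : V ≃ₗ[ℂ] V) : V →ₗ[ℂ] V)) * w g
  w_y : ∀ (g : G.W) (v : V), w g * y v = y (((g : V ≃ₗ[ℂ] V)) v) * w g
  rel : ∀ (v : V) (a : Module.Dual ℂ V),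
    y v * x a - x a * y v =
      algebraMap ℂ H (a v) -
        ∑ᶠ s : G.Refl, (c s * D.α s v * a (D.αv s)) • w s.1
  universal : ∀ (A : Type) [Ring A] [Algebra ℂ A]
      (xA : Module.Dual ℂ V →ₗ[ℂ] A) (yA : V →ₗ[ℂ] A) (wA : G.W →* A),
      (∀ a b, xA a * xA b = xA b * xA a) →
      (∀ u v, yA u * yA v = yA v * yA u) →
      (∀ (g : G.W) (a : Module.Dual ℂ V),
        wA g * xA a = xA (a ∘ₗ (((g⁻¹ : G.W) : V ≃ₗ[ℂ] V) : V →ₗ[ℂ] V)) * wA g) →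
      (∀ (g : G.W) (v : V), wA g * yA v = yA (((g : V ≃ₗ[ℂ] V)) v) * wA g) →
      (∀ (v : V) (a : Module.Dual ℂ V),
        yA v * xA a - xA a * yA v =
          algebraMap ℂ A (a v) -
            ∑ᶠ s : G.Refl, (c s * D.α s v * a (D.αv s)) • wA s.1) →
      ∃! φ : H →ₐ[ℂ] A,
        (∀ a, φ (x a) = xA a) ∧ (∀ v, φ (y v) = yA v) ∧ (∀ g, φ (w g) = wA g)

attribute [instance] RCA.ring RCA.alg

variable {G : CRG V} {D : ReflData G} {c : G.Refl → ℂ}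

/-- The category `𝒪_c(W)`: modules over `H_c` which are finitely generated and
on which `h` acts locally nilpotently. -/
structure CatO (R : RCA G D c) where
  M : Type
  [ab : AddCommGroup M]
  [mod : Module R.H M]
  locNilp : ∀ m : M, ∃ N : ℕ, ∀ L : List V, L.length = N →
    (L.map fun v => R.y v).prod • m = 0
  fg : Module.Finite R.H M

attribute [instance] CatO.ab CatO.mod

instance catO (R : RCA G D c) : CategoryTheory.Category (CatO R) where
  Hom A B := A.M →ₗ[R.H] B.M
  id A := LinearMap.id
  comp f g := g.comp f
  id_comp f := LinearMap.comp_id f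
  comp_id f := LinearMap.id_comp f
  assoc f g h := (LinearMap.comp_assoc _ _ _).symm

/-- A finite dimensional representation of `W`. -/
structure WRep (G : CRG V) where
  T : Type
  [ab : AddCommGroup T]
  [mod : Module ℂ T]
  [fd : FiniteDimensional ℂ T]
  ρ : G.W →* (T ≃ₗ[ℂ] T)

attribute [instance] WRep.ab WRep.mod WRep.fd

/-- Irreducibility of a representation of `W`. -/
def WRep.IsIrr {G : CRG V} (τ : WRep G) : Prop :=
  Nontrivial τ.T ∧ ∀ U : Submodule ℂ τ.T,
    (∀ (g : G.W) (t : τ.T), t ∈ U → τ.ρ g t ∈ U) → U = ⊥ ∨ U = ⊤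

/-- Isomorphism of representations of `W`. -/
def WRep.Iso {G : CRG V} (τ τ' : WRep G) : Prop :=
  ∃ e : τ.T ≃ₗ[ℂ] τ'.T, ∀ (g : G.W) (t : τ.T), e (τ.ρ g t) = τ'.ρ g (e t)

/-- `M`, together with the lowest weight inclusion `ι : τ → M`, is the Verma
module `Δ_c(τ) = H_c ⊗_{S(h)#W} τ`, presented via its universal property. -/
structure VermaStr (R : RCA G D c) (τ : WRep G) (M : Type) [AddCommGroup M]
    [Module R.H M] where
  ι : τ.T →+ M
  ι_smul : ∀ (a : ℂ) (t : τ.T), ι (a • t) = algebraMap ℂ R.H a • ι t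
  ι_y : ∀ (v : V) (t : τ.T), R.y v • ι t = 0
  ι_w : ∀ (g : G.W) (t : τ.T), R.w g • ι t = ι (τ.ρ g t)
  universal : ∀ (N : Type) [AddCommGroup N] [Module R.H N] (κ : τ.T →+ N),
      (∀ (a : ℂ) (t : τ.T), κ (a • t) = algebraMap ℂ R.H a • κ t) →
      (∀ (v : V) (t : τ.T), R.y v • κ t = 0) →
      (∀ (g : G.W) (t : τ.T), R.w g • κ t = κ (τ.ρ g t)) →
      ∃! φ : M →ₗ[R.H] N, ∀ t, φ (ι t) = κ t

/-- A greatest proper submodule (so the quotient is the unique simple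
quotient). -/
def IsGreatestProper {A : Type} [Ring A] {M : Type} [AddCommGroup M]
    [Module A M] (N : Submodule A M) : Prop :=
  N ≠ ⊤ ∧ ∀ N' : Submodule A M, N' ≠ ⊤ → N' ≤ N

end

section Stmt3
noncomputable section
section Reflections
noncomputable section

open Module

variable {V : Type} [AddCommGroup V] [Module ℂ V]
variable {G : CRG V} {D : ReflData G} {c : G.Refl → ℂ}

instance (G : CRG V) : Finite G.W := G.finite

instance (G : CRG V) : Finite G.Refl := inferInstanceAs (Finite {s : G.W // _})

instance (G : CRG V) : Fintype G.W := Fintype.ofFinite _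

instance (G : CRG V) : Fintype G.Refl := Fintype.ofFinite _

/-- Conjugation of reflections by elements of `W`. -/
def CRG.conjRefl (g : G.W) : G.Refl ≃ G.Refl where
  toFun s := ⟨g * s.1 * g⁻¹, conj_mem g s⟩
  invFun s := ⟨g⁻¹ * s.1 * g, by simpa using conj_mem g⁻¹ s⟩
  left_inv s := Subtype.ext (by simp [mul_assoc])
  right_inv s := Subtype.ext (by simp [mul_assoc])
where
  conj_mem (g : G.W) (s : G.Refl) :
      IsComplexReflection ((g * s.1 * g⁻¹ : G.W) : V ≃ₗ[ℂ] V) := by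
    have hs := s.2
    unfold IsComplexReflection at hs ⊢
    have h : ((g * s.1 * g⁻¹ : G.W) : V ≃ₗ[ℂ] V).toLinearMap - LinearMap.id =
        (g : V ≃ₗ[ℂ] V).toLinearMap ∘ₗ ((s.1 : V ≃ₗ[ℂ] V).toLinearMap - LinearMap.id) ∘ₗ
          ((g : V ≃ₗ[ℂ] V).symm).toLinearMap := by
      ext v
      simp
    rw [h, LinearMap.range_comp, LinearMap.range_comp_of_range_eq_top _ (LinearEquiv.range _)]
    exact (LinearEquiv.finrank_map_eq (g : V ≃ₗ[ℂ] V) _).trans hs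

theorem CRG.conjRefl_val (g : G.W) (s : G.Refl) : (G.conjRefl g s).1 = g * s.1 * g⁻¹ := rfl

namespace ReflData

variable (D)

theorem lam_ne_zero (s : G.Refl) : D.lam s ≠ 0 := by
  intro h
  apply D.α_ne s
  ext v
  simpa [h] using D.eig_α s ((s.1 : V ≃ₗ[ℂ] V) v)

theorem α_apply (s : G.Refl) (v : V) :
    D.α s v = D.lam s * D.α s ((s.1 : V ≃ₗ[ℂ] V) v) := by
  simpa using D.eig_α s ((s.1 : V ≃ₗ[ℂ] V) v)

theorem apply_sub_self (s : G.Refl) (v : V) :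
    (s.1 : V ≃ₗ[ℂ] V) v - v = (((D.lam s)⁻¹ - 1) / 2 * D.α s v) • D.αv s := by
  obtain ⟨μ, hμ, hs⟩ := D.eig_αv s
  have hmem : D.αv s ∈
      LinearMap.range ((s.1 : V ≃ₗ[ℂ] V).toLinearMap - LinearMap.id) := by
    refine ⟨(μ - 1)⁻¹ • D.αv s, ?_⟩
    have : μ - 1 ≠ 0 := sub_ne_zero.mpr hμ
    simp only [LinearMap.sub_apply, LinearEquiv.coe_coe, map_smul, hs, LinearMap.id_apply]
    rw [inv_smul_eq_iff₀ this, sub_smul, one_smul]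
  have hne : (⟨D.αv s, hmem⟩ :
      LinearMap.range ((s.1 : V ≃ₗ[ℂ] V).toLinearMap - LinearMap.id)) ≠ 0 := by
    simpa [Subtype.ext_iff] using D.αv_ne s
  obtain ⟨β, hβ⟩ := (finrank_eq_one_iff_of_nonzero' _ hne).mp s.2
    ⟨(s.1 : V ≃ₗ[ℂ] V) v - v, v, rfl⟩
  have hβ' : β • D.αv s = (s.1 : V ≃ₗ[ℂ] V) v - v := congrArg Subtype.val hβ
  have h := congrArg (D.α s) hβ'
  have hl := D.lam_ne_zero s
  have ha := D.α_apply s v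
  simp only [map_smul, map_sub, D.pairing, smul_eq_mul] at h
  rw [← hβ']
  congr 1
  field_simp
  linear_combination D.lam s * h - ha

theorem sub_symm_apply (s : G.Refl) (v : V) :
    v - (s.1 : V ≃ₗ[ℂ] V).symm v = ((1 - D.lam s) / 2 * D.α s v) • D.αv s := by
  have h := D.apply_sub_self s ((s.1 : V ≃ₗ[ℂ] V).symm v)
  rw [LinearEquiv.apply_symm_apply, D.eig_α] at h
  rw [h]
  congr 1
  have := D.lam_ne_zero s
  field_simp

theorem sub_symm_apply_αv (s : G.Refl) :
    (s.1 : V ≃ₗ[ℂ] V).symm (D.αv s) = D.lam s • D.αv s := by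
  have h := D.sub_symm_apply s (D.αv s)
  rw [D.pairing, sub_eq_iff_eq_add, ← sub_eq_iff_eq_add'] at h
  rw [← h, ← sub_eq_zero]
  module

/-- The eigenvalues `λ_s` are constant on conjugacy classes. -/
theorem lam_conjRefl (g : G.W) (s : G.Refl) : D.lam (G.conjRefl g s) = D.lam s := by
  set t := G.conjRefl g s with ht
  set u := (g : V ≃ₗ[ℂ] V) (D.αv s)
  have hu0 : u ≠ 0 := by simpa [u] using D.αv_ne s
  have hu : (t.1 : V ≃ₗ[ℂ] V).symm u = D.lam s • u := by
    rw [LinearEquiv.symm_apply_eq, map_smul]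
    have h1 : (t.1 : V ≃ₗ[ℂ] V) u = (g : V ≃ₗ[ℂ] V) ((s.1 : V ≃ₗ[ℂ] V) (D.αv s)) := by
      simp only [ht, CRG.conjRefl_val, Subgroup.coe_mul, LinearEquiv.mul_apply, u]
      congr 2
      exact LinearEquiv.symm_apply_apply (g : V ≃ₗ[ℂ] V) _
    rw [h1, ← map_smul, ← map_smul, ← D.sub_symm_apply_αv, LinearEquiv.apply_symm_apply]
  have h := D.sub_symm_apply t u
  rw [hu] at h
  have hs : 1 - D.lam s ≠ 0 := sub_ne_zero.mpr (D.lam_ne_one s).symm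
  have hu' : u = ((1 - D.lam s)⁻¹ * ((1 - D.lam t) / 2 * D.α t u)) • D.αv t := by
    rw [mul_smul, ← h, eq_inv_smul_iff₀ hs, sub_smul, one_smul]
  have h2 : (t.1 : V ≃ₗ[ℂ] V).symm u = D.lam t • u := by
    rw [hu', map_smul, D.sub_symm_apply_αv, smul_comm]
  exact smul_left_injective ℂ hu0 (h2.symm.trans hu)

/-- The rescaled parameter `2 c_s / (1 - λ_s)`. -/
def coeff (c : G.Refl → ℂ) (s : G.Refl) : ℂ := 2 * c s / (1 - D.lam s)

theorem coeff_conjRefl (hc : IsConjInvariant c) (g : G.W) (s : G.Refl) :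
    D.coeff c (G.conjRefl g s) = D.coeff c s := by
  rw [coeff, coeff, D.lam_conjRefl, hc s _ ⟨g, rfl⟩]

theorem coeff_mul_apply_sub (s : G.Refl) (v : V) (a : Dual ℂ V) :
    D.coeff c s * a (v - (s.1 : V ≃ₗ[ℂ] V).symm v) = c s * D.α s v * a (D.αv s) := by
  have hs : 1 - D.lam s ≠ 0 := sub_ne_zero.mpr (D.lam_ne_one s).symm
  rw [D.sub_symm_apply, map_smul, coeff, smul_eq_mul]
  field_simp

/-- The commutator of `y v` and `x a`, written without roots and coroots. -/
theorem finsum_rel_eq {A : Type*} [Ring A] [Algebra ℂ A] (w : G.W → A) (v : V)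
    (a : Dual ℂ V) :
    ∑ᶠ s : G.Refl, (c s * D.α s v * a (D.αv s)) • w s.1 =
      ∑ s : G.Refl, (D.coeff c s * a (v - (s.1 : V ≃ₗ[ℂ] V).symm v)) • w s.1 := by
  rw [finsum_eq_sum_of_fintype]
  simp only [coeff_mul_apply_sub]

theorem apply_sub_smul_comm (D : ReflData G) (s : G.Refl) (u v : V) (a : Dual ℂ V) :
    a (v - (s.1 : V ≃ₗ[ℂ] V).symm v) • (u - (s.1 : V ≃ₗ[ℂ] V) u) =
      a (u - (s.1 : V ≃ₗ[ℂ] V).symm u) • (v - (s.1 : V ≃ₗ[ℂ] V) v) := by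
  rw [← neg_sub ((s.1 : V ≃ₗ[ℂ] V) u) u, ← neg_sub ((s.1 : V ≃ₗ[ℂ] V) v) v, D.apply_sub_self,
    D.apply_sub_self, D.sub_symm_apply, D.sub_symm_apply, map_smul, map_smul, smul_neg, smul_neg, smul_smul, smul_smul]
  congr 2
  simp only [smul_eq_mul]
  ring

/-- The `y v` commute up to an operator commuting with all `x a`. -/
theorem commutator_commute {A : Type*} [Ring A] [Algebra ℂ A] (x : Dual ℂ V →ₗ[ℂ] A)
    (y : V →ₗ[ℂ] A) (w : G.W → A)
    (w_y : ∀ (g : G.W) (v : V), w g * y v = y ((g : V ≃ₗ[ℂ] V) v) * w g)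
    (rel : ∀ (v : V) (a : Dual ℂ V), y v * x a - x a * y v = algebraMap ℂ A (a v) -
      ∑ s : G.Refl, (D.coeff c s * a (v - (s.1 : V ≃ₗ[ℂ] V).symm v)) • w s.1)
    (u v : V) (a : Dual ℂ V) :
    (y u * y v - y v * y u) * x a = x a * (y u * y v - y v * y u) := by
  have key (u v : V) : y u * (y v * x a - x a * y v) - (y v * x a - x a * y v) * y u =
      - ∑ s : G.Refl, D.coeff c s • (y (a (v - (s.1 : V ≃ₗ[ℂ] V).symm v) •
        (u - (s.1 : V ≃ₗ[ℂ] V) u)) * w s.1) := by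
    rw [rel, mul_sub, sub_mul, sub_sub_sub_comm, Algebra.commutes, sub_self, zero_sub,
      Finset.mul_sum, Finset.sum_mul, ← Finset.sum_sub_distrib]
    congr 1
    refine Finset.sum_congr rfl fun s _ => ?_
    rw [mul_smul_comm, smul_mul_assoc, w_y, ← smul_sub, ← sub_mul, ← map_sub, map_smul,
      smul_mul_assoc, smul_smul]
  have h := (key u v).trans (Eq.trans (by simp only [D.apply_sub_smul_comm _ u v]) (key v u).symm)
  rw [← sub_eq_zero] at h ⊢
  rw [← h]
  noncomm_ring

end ReflData

end
end Reflections

section Dunkl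
noncomputable section

open Module MvPolynomial

variable {V : Type} [AddCommGroup V] [Module ℂ V] [FiniteDimensional ℂ V]
variable {G : CRG V} {D : ReflData G} {c : G.Refl → ℂ}

variable (V) in
/-- The polynomial functions on `V`, in coordinates. -/
abbrev PolyFun : Type := MvPolynomial (Fin (finrank ℂ V)) ℂ

/-- A linear form, seen as a polynomial function. -/
def linForm : Dual ℂ V →ₗ[ℂ] PolyFun V := (finBasis ℂ V).dualBasis.constr ℂ X

theorem linForm_coord (i : Fin (finrank ℂ V)) : linForm ((finBasis ℂ V).coord i) = X i := by
  rw [← (finBasis ℂ V).coe_dualBasis]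
  exact Basis.constr_basis _ _ _ _

/-- The action of a linear automorphism on polynomial functions. -/
def polyAct (g : V ≃ₗ[ℂ] V) : PolyFun V →ₐ[ℂ] PolyFun V :=
  aeval fun i => linForm ((finBasis ℂ V).coord i ∘ₗ g.symm.toLinearMap)

theorem polyAct_linForm (g : V ≃ₗ[ℂ] V) (a : Dual ℂ V) :
    polyAct g (linForm a) = linForm (a ∘ₗ g.symm.toLinearMap) := by
  have : (polyAct g).toLinearMap ∘ₗ linForm = linForm ∘ₗ LinearMap.lcomp ℂ ℂ g.symm.toLinearMap := by
    refine (finBasis ℂ V).dualBasis.ext fun i => ?_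
    simp [linForm_coord, polyAct, LinearMap.lcomp_apply']
  exact LinearMap.congr_fun this a

theorem polyFun_algHom_ext {A : Type*} [Semiring A] [Algebra ℂ A] {f g : PolyFun V →ₐ[ℂ] A}
    (h : ∀ a, f (linForm a) = g (linForm a)) : f = g :=
  MvPolynomial.algHom_ext fun i => by simpa [linForm_coord] using h ((finBasis ℂ V).coord i)

theorem polyAct_one : polyAct (1 : V ≃ₗ[ℂ] V) = AlgHom.id ℂ _ :=
  polyFun_algHom_ext fun a => by rw [polyAct_linForm]; rfl

theorem polyAct_mul (g h : V ≃ₗ[ℂ] V) : polyAct (g * h) = (polyAct g).comp (polyAct h) :=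
  polyFun_algHom_ext fun a => by
    rw [AlgHom.comp_apply, polyAct_linForm, polyAct_linForm, polyAct_linForm]; rfl

/-- The directional derivative along `v`. -/
def polyDeriv : V →ₗ[ℂ] Derivation ℂ (PolyFun V) (PolyFun V) :=
  (mkDerivationEquiv ℂ).toLinearMap.restrictScalars ℂ ∘ₗ
    LinearMap.pi fun i => Algebra.linearMap ℂ (PolyFun V) ∘ₗ (finBasis ℂ V).coord i

theorem polyDeriv_linForm (v : V) (a : Dual ℂ V) :
    polyDeriv v (linForm a) = C (a v) := by
  have : (polyDeriv v).toLinearMap ∘ₗ linForm =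
      Algebra.linearMap ℂ (PolyFun V) ∘ₗ Dual.eval ℂ V v := by
    refine (finBasis ℂ V).dualBasis.ext fun i => ?_
    simp [linForm_coord, polyDeriv, mkDerivationEquiv]
  exact LinearMap.congr_fun this a

theorem linForm_ne_zero {a : Dual ℂ V} (ha : a ≠ 0) : linForm a ≠ 0 := by
  contrapose! ha
  ext v
  have h := polyDeriv_linForm v a
  rwa [ha, map_zero, eq_comm, C_eq_zero] at h

variable (D)

theorem linForm_sub_polyAct (s : G.Refl) (a : Dual ℂ V) :
    linForm a - polyAct s.1 (linForm a) =
      ((1 - D.lam s) / 2 * a (D.αv s)) • linForm (D.α s) := by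
  rw [polyAct_linForm, ← map_sub, ← map_smul]
  congr 1
  ext v
  have := D.sub_symm_apply s v
  simp only [LinearMap.sub_apply, LinearMap.comp_apply, LinearEquiv.coe_coe, ← map_sub, this,
    map_smul, LinearMap.smul_apply, smul_eq_mul]
  ring

theorem linForm_dvd_sub_polyAct (s : G.Refl) (f : PolyFun V) :
    linForm (D.α s) ∣ f - polyAct s.1 f := by
  have h : (Ideal.Quotient.mkₐ ℂ (Ideal.span {linForm (D.α s)})).comp (polyAct s.1) =
      Ideal.Quotient.mkₐ ℂ (Ideal.span {linForm (D.α s)}) := by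
    refine polyFun_algHom_ext fun a => Eq.symm ?_
    rw [← sub_eq_zero, AlgHom.comp_apply, ← map_sub, linForm_sub_polyAct D, map_smul]
    simp
  rw [← Ideal.mem_span_singleton, ← Ideal.Quotient.eq]
  exact (DFunLike.congr_fun h f).symm

/-- The divided difference operator `f ↦ (f - s f) / α_s`. -/
def divDiff (s : G.Refl) : PolyFun V →ₗ[ℂ] PolyFun V where
  toFun f := (linForm_dvd_sub_polyAct D s f).choose
  map_add' f g := by
    apply mul_left_cancel₀ (linForm_ne_zero (D.α_ne s))
    rw [mul_add]
    iterate 3 rw [← (linForm_dvd_sub_polyAct D s _).choose_spec]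
    rw [map_add]
    ring
  map_smul' r f := by
    apply mul_left_cancel₀ (linForm_ne_zero (D.α_ne s))
    rw [mul_smul_comm]
    iterate 2 rw [← (linForm_dvd_sub_polyAct D s _).choose_spec]
    rw [map_smul, RingHom.id_apply, smul_sub]

theorem linForm_mul_divDiff (s : G.Refl) (f : PolyFun V) :
    linForm (D.α s) * divDiff D s f = f - polyAct s.1 f :=
  (linForm_dvd_sub_polyAct D s f).choose_spec.symm

theorem divDiff_linForm_mul (s : G.Refl) (a : Dual ℂ V) (f : PolyFun V) :
    divDiff D s (linForm a * f) = linForm a * divDiff D s f +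
      ((1 - D.lam s) / 2 * a (D.αv s)) • polyAct s.1 f := by
  apply mul_left_cancel₀ (linForm_ne_zero (D.α_ne s))
  rw [mul_add, mul_left_comm, linForm_mul_divDiff, linForm_mul_divDiff, mul_smul_comm,
    ← smul_mul_assoc, ← linForm_sub_polyAct, map_mul]
  ring

theorem divDiff_C (s : G.Refl) (z : ℂ) : divDiff D s (C z) = 0 := by
  apply mul_left_cancel₀ (linForm_ne_zero (D.α_ne s))
  rw [linForm_mul_divDiff, ← algebraMap_eq, AlgHom.commutes, sub_self, mul_zero]

variable (G) in
/-- The space of the Dunkl representation attached to the regular representation of `W`. -/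
abbrev DunklSpace : Type := G.W → PolyFun V

/-- Multiplication by linear forms on the Dunkl representation. -/
def dunklX : Dual ℂ V →ₗ[ℂ] End ℂ (DunklSpace G) :=
  (Algebra.lsmul ℂ ℂ (DunklSpace G)).toLinearMap ∘ₗ linForm

/-- The action of `W` on the Dunkl representation. -/
def dunklW : G.W →* End ℂ (DunklSpace G) where
  toFun g := LinearMap.pi fun h => (polyAct (g : V ≃ₗ[ℂ] V)).toLinearMap ∘ₗ
    LinearMap.proj (g⁻¹ * h)
  map_one' := by
    ext F h
    simp [polyAct_one]
  map_mul' g g' := by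
    refine LinearMap.ext fun F => funext fun h => ?_
    simp [polyAct_mul, mul_assoc]

/-- The Dunkl operators. -/
def dunklY (c : G.Refl → ℂ) : V →ₗ[ℂ] End ℂ (DunklSpace G) where
  toFun v := LinearMap.pi fun h => (polyDeriv v).toLinearMap ∘ₗ LinearMap.proj h -
    ∑ s : G.Refl, (D.coeff c s * D.α s v) • divDiff D s ∘ₗ LinearMap.proj (s.1⁻¹ * h)
  map_add' u v := by
    refine LinearMap.ext fun F => funext fun h => ?_
    simp [mul_add, add_smul, Finset.sum_add_distrib]
    abel
  map_smul' r v := by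
    refine LinearMap.ext fun F => funext fun h => ?_
    simp [Finset.smul_sum, smul_smul, mul_left_comm, smul_sub]

variable {D}

@[simp] theorem dunklX_apply (a : Dual ℂ V) (F : DunklSpace G) (h : G.W) :
    dunklX a F h = linForm a * F h := rfl

@[simp] theorem dunklW_apply (g : G.W) (F : DunklSpace G) (h : G.W) :
    dunklW g F h = polyAct (g : V ≃ₗ[ℂ] V) (F (g⁻¹ * h)) := rfl

variable (D) in
theorem dunklY_apply (v : V) (F : DunklSpace G) (h : G.W) :
    dunklY D c v F h = polyDeriv v (F h) -
      ∑ s : G.Refl, (D.coeff c s * D.α s v) • divDiff D s (F (s.1⁻¹ * h)) := by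
  simp [dunklY]

/-- The constant functions in the Dunkl representation. -/
def dunklConst (z : G.W → ℂ) : DunklSpace G := fun h => C (z h)

theorem dunklW_const (g : G.W) (z : G.W → ℂ) :
    dunklW g (dunklConst z) = dunklConst fun h => z (g⁻¹ * h) := by
  funext h
  simp only [dunklW_apply, dunklConst, ← algebraMap_eq, AlgHom.commutes]

theorem dunklY_const (v : V) (z : G.W → ℂ) : dunklY D c v (dunklConst z) = 0 := by
  funext h
  simp [dunklY_apply, dunklConst, divDiff_C, derivation_C]

theorem dunkl_eq_zero {K : End ℂ (DunklSpace G)} (g : V ≃ₗ[ℂ] V)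
    (hK : ∀ a, K * dunklX a = dunklX (a ∘ₗ g.symm.toLinearMap) * K)
    (h0 : ∀ z, K (dunklConst z) = 0) : K = 0 := by
  have hmul (p : PolyFun V) : ∀ F, K (p • F) = polyAct g p • K F := by
    induction p using MvPolynomial.induction_on with
    | C r =>
      intro F
      rw [← algebraMap_eq, AlgHom.commutes, algebraMap_smul, algebraMap_smul, map_smul]
    | add p q hp hq => intro F; rw [add_smul, map_add, hp, hq, map_add, add_smul]
    | mul_X p i hp =>
      intro F
      rw [mul_smul, hp, map_mul, mul_smul, ← linForm_coord, polyAct_linForm]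
      congr 1
      exact LinearMap.congr_fun (hK _) F
  classical
  refine LinearMap.ext fun F => ?_
  have hF : F = ∑ h, F h • (dunklConst (Pi.single h 1) : DunklSpace G) := by
    funext h'
    simp [dunklConst, Finset.sum_apply, Pi.single_apply]
  rw [hF, map_sum]
  simp [hmul, h0]

variable (D)

theorem dunkl_rel (v : V) (a : Dual ℂ V) :
    dunklY D c v * dunklX a - dunklX a * dunklY D c v =
      algebraMap ℂ (End ℂ (DunklSpace G)) (a v) -
        ∑ s : G.Refl, (D.coeff c s * a (v - (s.1 : V ≃ₗ[ℂ] V).symm v)) • dunklW s.1 := by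
  refine LinearMap.ext fun F => funext fun h => ?_
  simp only [LinearMap.sub_apply, Module.End.mul_apply, Pi.sub_apply, dunklX_apply,
    dunklY_apply, divDiff_linForm_mul, LinearMap.sum_apply, Finset.sum_apply,
    LinearMap.smul_apply, Pi.smul_apply, dunklW_apply, Derivation.leibniz, polyDeriv_linForm,
    Module.algebraMap_end_apply, smul_add, Finset.sum_add_distrib, mul_sub, Finset.mul_sum,
    mul_smul_comm, smul_smul, smul_eq_mul, D.coeff_mul_apply_sub]
  have (s : G.Refl) : D.coeff c s * D.α s v * ((1 - D.lam s) / 2 * a (D.αv s)) =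
      c s * D.α s v * a (D.αv s) := by
    rw [← D.coeff_mul_apply_sub, D.sub_symm_apply, map_smul, smul_eq_mul]
    ring
  simp only [this, smul_eq_C_mul]
  ring

theorem dunkl_w_x (g : G.W) (a : Dual ℂ V) :
    dunklW g * dunklX a =
      dunklX (a ∘ₗ (((g⁻¹ : G.W) : V ≃ₗ[ℂ] V) : V →ₗ[ℂ] V)) * dunklW g := by
  refine LinearMap.ext fun F => funext fun h => ?_
  simp only [Module.End.mul_apply, dunklW_apply, dunklX_apply, map_mul, polyAct_linForm]
  rfl

theorem intertwine_commutator {A : Type*} [Ring A] {w y y' x x' : A} (hx : w * x = x' * w)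
    (h : w * (y * x - x * y) = (y' * x' - x' * y') * w) :
    (w * y - y' * w) * x = x' * (w * y - y' * w) := by
  rw [← sub_eq_zero] at hx h ⊢
  have key : (w * y - y' * w) * x - x' * (w * y - y' * w) =
      (w * (y * x - x * y) - (y' * x' - x' * y') * w) + (w * x - x' * w) * y -
        y' * (w * x - x' * w) := by
    noncomm_ring
  rw [key, h, hx]
  simp

theorem dunkl_w_y (hc : IsConjInvariant c) (g : G.W) (v : V) :
    dunklW g * dunklY D c v = dunklY D c ((g : V ≃ₗ[ℂ] V) v) * dunklW g := by
  rw [← sub_eq_zero]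
  refine dunkl_eq_zero (g : V ≃ₗ[ℂ] V) (fun a => ?_) fun z => ?_
  · have hx : dunklW g * dunklX a = dunklX (a ∘ₗ (g : V ≃ₗ[ℂ] V).symm.toLinearMap) * dunklW g :=
      dunkl_w_x g a
    have h1 := congrArg (dunklW g * ·) (dunkl_rel D (c := c) v a)
    have h2 := congrArg (· * dunklW g) (dunkl_rel D (c := c) ((g : V ≃ₗ[ℂ] V) v)
      (a ∘ₗ (g : V ≃ₗ[ℂ] V).symm.toLinearMap))
    have h3 : dunklW g * (algebraMap ℂ (End ℂ (DunklSpace G)) (a v) -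
        ∑ s : G.Refl, (D.coeff c s * a (v - (s.1 : V ≃ₗ[ℂ] V).symm v)) • dunklW s.1) =
        (algebraMap ℂ (End ℂ (DunklSpace G))
          ((a ∘ₗ (g : V ≃ₗ[ℂ] V).symm.toLinearMap) ((g : V ≃ₗ[ℂ] V) v)) -
        ∑ s : G.Refl, (D.coeff c s * (a ∘ₗ (g : V ≃ₗ[ℂ] V).symm.toLinearMap)
          ((g : V ≃ₗ[ℂ] V) v - (s.1 : V ≃ₗ[ℂ] V).symm ((g : V ≃ₗ[ℂ] V) v))) • dunklW s.1) *
          dunklW g := by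
      rw [mul_sub, sub_mul, ← Algebra.commutes, Finset.mul_sum, Finset.sum_mul]
      have hg (u : V) : ((g⁻¹ : G.W) : V ≃ₗ[ℂ] V) ((g : V ≃ₗ[ℂ] V) u) = u :=
        LinearEquiv.symm_apply_apply _ _
      congr 1
      · simp
      · refine Finset.sum_equiv (G.conjRefl g) (by simp) fun s _ => ?_
        have ha : (a ∘ₗ (g : V ≃ₗ[ℂ] V).symm.toLinearMap) ((g : V ≃ₗ[ℂ] V) v -
            ((G.conjRefl g s).1 : V ≃ₗ[ℂ] V).symm ((g : V ≃ₗ[ℂ] V) v)) =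
            a (v - (s.1 : V ≃ₗ[ℂ] V).symm v) := by
          rw [LinearMap.comp_apply, map_sub, LinearEquiv.coe_coe, LinearEquiv.symm_apply_apply]
          congr 2
          rw [LinearEquiv.symm_apply_eq, LinearEquiv.symm_apply_eq]
          simp only [CRG.conjRefl_val, Subgroup.coe_mul, LinearEquiv.mul_apply]
          rw [hg, LinearEquiv.apply_symm_apply]
        rw [ha, D.coeff_conjRefl hc, mul_smul_comm, smul_mul_assoc, ← map_mul, ← map_mul,
          CRG.conjRefl_val, inv_mul_cancel_right]
    exact intertwine_commutator hx (h1.trans (h3.trans h2.symm))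
  · simp [dunklW_const, dunklY_const]

theorem dunkl_comm_y (hc : IsConjInvariant c) (u v : V) :
    dunklY D c u * dunklY D c v = dunklY D c v * dunklY D c u := by
  rw [← sub_eq_zero]
  refine dunkl_eq_zero 1 (fun a => ?_) fun z => ?_
  · exact D.commutator_commute dunklX (dunklY D c) dunklW (dunkl_w_y D hc) (dunkl_rel D) u v a
  · simp [dunklY_const]

/-- The Dunkl representation of the rational Cherednik algebra. -/
theorem exists_dunkl_rep (hc : IsConjInvariant c) (R : RCA G D c) :
    ∃ φ : R.H →ₐ[ℂ] End ℂ (DunklSpace G), (∀ a, φ (R.x a) = dunklX a) ∧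
      (∀ v, φ (R.y v) = dunklY D c v) ∧ ∀ g, φ (R.w g) = dunklW g := by
  refine (R.universal _ dunklX (dunklY D c) dunklW (fun a b => ?_) (dunkl_comm_y D hc)
    (dunkl_w_x) (dunkl_w_y D hc) fun v a => ?_).exists
  · refine LinearMap.ext fun F => funext fun h => ?_
    simp [mul_left_comm]
  · rw [D.finsum_rel_eq, dunkl_rel]

end
end Dunkl

section LowestWeight
noncomputable section

open Module

variable {V : Type} [AddCommGroup V] [Module ℂ V]
variable {G : CRG V} {D : ReflData G} {c : G.Refl → ℂ}

/-- The scalar by which the central element `∑ s, (2 c_s / (1 - λ_s)) s` acts on an irreducible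
representation of `W`. -/
theorem WRep.IsIrr.exists_scalar {τ : WRep G} (hτ : τ.IsIrr) (D : ReflData G)
    (hc : IsConjInvariant c) :
    ∃ h : ℂ, ∀ t : τ.T, ∑ s : G.Refl, D.coeff c s • τ.ρ s.1 t = h • t := by
  obtain ⟨hnt, hsub⟩ := hτ
  let z : End ℂ τ.T := ∑ s : G.Refl, D.coeff c s • (τ.ρ s.1).toLinearMap
  have hz (t : τ.T) : z t = ∑ s : G.Refl, D.coeff c s • τ.ρ s.1 t := by simp [z]
  have hcomm (g : G.W) (t : τ.T) : z (τ.ρ g t) = τ.ρ g (z t) := by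
    rw [hz, hz, map_sum]
    symm
    refine Finset.sum_equiv (G.conjRefl g) (by simp) fun s _ => ?_
    rw [D.coeff_conjRefl hc, map_smul, ← LinearEquiv.mul_apply, ← LinearEquiv.mul_apply,
      ← map_mul, ← map_mul, CRG.conjRefl_val, inv_mul_cancel_right]
  obtain ⟨h, hh⟩ := End.exists_eigenvalue z
  refine ⟨h, fun t => ?_⟩
  have htop := (hsub (z.eigenspace h) fun g t ht => by
    rw [End.mem_eigenspace_iff] at ht ⊢
    rw [hcomm, ht, map_smul]).resolve_left hh
  rw [← hz, ← End.mem_eigenspace_iff, htop]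
  trivial

namespace RCA

variable (R : RCA G D c)

theorem rel_sum (v : V) (a : Dual ℂ V) :
    R.y v * R.x a - R.x a * R.y v = algebraMap ℂ R.H (a v) -
      ∑ s : G.Refl, (D.coeff c s * a (v - (s.1 : V ≃ₗ[ℂ] V).symm v)) • R.w s.1 := by
  rw [R.rel, D.finsum_rel_eq]

theorem subalgebra_eq_top (A : Subalgebra ℂ R.H) (hx : ∀ a, R.x a ∈ A) (hy : ∀ v, R.y v ∈ A)
    (hw : ∀ g, R.w g ∈ A) : A = ⊤ := by
  let xA : Dual ℂ V →ₗ[ℂ] A :=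
    { toFun := fun a => ⟨R.x a, hx a⟩
      map_add' := fun a b => Subtype.ext (map_add R.x a b)
      map_smul' := fun r a => Subtype.ext (map_smul R.x r a) }
  let yA : V →ₗ[ℂ] A :=
    { toFun := fun v => ⟨R.y v, hy v⟩
      map_add' := fun u v => Subtype.ext (map_add R.y u v)
      map_smul' := fun r v => Subtype.ext (map_smul R.y r v) }
  let wA : G.W →* A :=
    { toFun := fun g => ⟨R.w g, hw g⟩
      map_one' := Subtype.ext (map_one R.w)
      map_mul' := fun g h => Subtype.ext (map_mul R.w g h) }
  obtain ⟨φ, ⟨hφx, hφy, hφw⟩, -⟩ := R.universal A xA yA wA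
    (fun a b => Subtype.ext (R.comm_x a b)) (fun u v => Subtype.ext (R.comm_y u v))
    (fun g a => Subtype.ext (R.w_x g a)) (fun g v => Subtype.ext (R.w_y g v)) (fun v a => by
      apply Subtype.ext
      rw [D.finsum_rel_eq]
      simpa [xA, yA, wA] using R.rel_sum v a)
  have h := (R.universal R.H R.x R.y R.w R.comm_x R.comm_y R.w_x R.w_y R.rel).unique
    (y₁ := A.val.comp φ) (y₂ := AlgHom.id ℂ R.H) ⟨fun a => by simp [hφx, xA], fun v => by simp [hφy, yA],
      fun g => by simp [hφw, wA]⟩ ⟨fun a => rfl, fun v => rfl, fun g => rfl⟩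
  refine eq_top_iff.mpr fun r _ => ?_
  rw [← show A.val.comp φ r = r from DFunLike.congr_fun h r]
  exact (φ r).2

section Modules

variable {M : Type} [AddCommGroup M] [Module ℂ M] [Module R.H M] [IsScalarTower ℂ R.H M]

theorem smul_mem_of_stable (S : Submodule ℂ M) (hx : ∀ a, ∀ m ∈ S, R.x a • m ∈ S)
    (hy : ∀ v, ∀ m ∈ S, R.y v • m ∈ S) (hw : ∀ g, ∀ m ∈ S, R.w g • m ∈ S) (r : R.H) {m : M}
    (hm : m ∈ S) : r • m ∈ S := by
  let A : Subalgebra ℂ R.H :=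
    { carrier := {r | ∀ m ∈ S, r • m ∈ S}
      mul_mem' := fun ha hb m hm => by rw [mul_smul]; exact ha _ (hb _ hm)
      add_mem' := fun ha hb m hm => by rw [add_smul]; exact S.add_mem (ha _ hm) (hb _ hm)
      algebraMap_mem' := fun z m hm => by rw [algebraMap_smul]; exact S.smul_mem _ hm }
  have h : r ∈ A := by
    rw [R.subalgebra_eq_top A hx hy hw]
    trivial
  exact h m hm

theorem eq_top_of_stable (S : Submodule ℂ M) (hx : ∀ a, ∀ m ∈ S, R.x a • m ∈ S)
    (hy : ∀ v, ∀ m ∈ S, R.y v • m ∈ S) (hw : ∀ g, ∀ m ∈ S, R.w g • m ∈ S) {X : Set M}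
    (hX : Submodule.span R.H X = ⊤) (hXS : X ⊆ S) : S = ⊤ := by
  refine eq_top_iff.mpr fun m _ => ?_
  have hm : m ∈ Submodule.span R.H X := hX ▸ trivial
  induction hm using Submodule.span_induction with
  | mem m hm => exact hXS hm
  | zero => exact S.zero_mem
  | add m n _ _ hm hn => exact S.add_mem (hm trivial) (hn trivial)
  | smul r m _ hm => exact R.smul_mem_of_stable S hx hy hw r (hm trivial)

theorem y_smul_x_smul (v : V) (a : Dual ℂ V) (m : M) :
    R.y v • R.x a • m = R.x a • R.y v • m + (a v • m -
      ∑ s : G.Refl, (D.coeff c s * a (v - (s.1 : V ≃ₗ[ℂ] V).symm v)) • R.w s.1 • m) := by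
  have h := congrArg (· • m) (R.rel_sum v a)
  simp only [sub_smul, mul_smul, Finset.sum_smul, smul_assoc, algebraMap_smul] at h
  simp only [mul_smul]
  rw [← h, add_sub_cancel]

/-! ### Local nilpotency -/

variable (M) in
/-- The vectors killed by all words of length `n` in the `y v`. -/
def nilpFilt : ℕ → Submodule ℂ M
  | 0 => ⊥
  | n + 1 => ⨅ v, (nilpFilt n).comap (Algebra.lsmul ℂ ℂ M (R.y v))

theorem mem_nilpFilt_succ {n : ℕ} {m : M} :
    m ∈ R.nilpFilt M (n + 1) ↔ ∀ v, R.y v • m ∈ R.nilpFilt M n := by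
  simp [nilpFilt]

theorem mem_nilpFilt_iff {n : ℕ} {m : M} : m ∈ R.nilpFilt M n ↔
    ∀ L : List V, L.length = n → (L.map fun v => R.y v).prod • m = 0 := by
  induction n generalizing m with
  | zero => simp [nilpFilt]
  | succ n ih =>
    simp only [mem_nilpFilt_succ, ih]
    constructor
    · intro h L hL
      obtain rfl | ⟨L, v, rfl⟩ := L.eq_nil_or_concat
      · simp at hL
      · simpa [mul_smul] using h v L (by simpa using hL)
    · intro h v L hL
      simpa [mul_smul] using h (L ++ [v]) (by simpa using hL)

theorem nilpFilt_le_succ (n : ℕ) : R.nilpFilt M n ≤ R.nilpFilt M (n + 1) := by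
  induction n with
  | zero => exact bot_le
  | succ n ih => exact fun m hm => R.mem_nilpFilt_succ.mpr fun v => ih (R.mem_nilpFilt_succ.mp hm v)

theorem nilpFilt_mono : Monotone (R.nilpFilt M) := monotone_nat_of_le_succ R.nilpFilt_le_succ

theorem w_smul_mem_nilpFilt (n : ℕ) (g : G.W) {m : M} (hm : m ∈ R.nilpFilt M n) :
    R.w g • m ∈ R.nilpFilt M n := by
  induction n generalizing m with
  | zero =>
    obtain rfl : m = 0 := hm
    rw [smul_zero]
    exact zero_mem _
  | succ n ih =>
    refine R.mem_nilpFilt_succ.mpr fun v => ?_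
    have h := R.w_y g ((g : V ≃ₗ[ℂ] V).symm v)
    rw [LinearEquiv.apply_symm_apply] at h
    rw [← mul_smul, ← h, mul_smul]
    exact ih (R.mem_nilpFilt_succ.mp hm _)

theorem x_smul_mem_nilpFilt (n : ℕ) (a : Dual ℂ V) {m : M} (hm : m ∈ R.nilpFilt M n) :
    R.x a • m ∈ R.nilpFilt M (n + 1) := by
  induction n generalizing m with
  | zero =>
    obtain rfl : m = 0 := hm
    rw [smul_zero]
    exact zero_mem _
  | succ n ih =>
    refine R.mem_nilpFilt_succ.mpr fun v => ?_
    rw [y_smul_x_smul]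
    refine add_mem (ih (R.mem_nilpFilt_succ.mp hm v)) (sub_mem (Submodule.smul_mem _ _ hm)
      (sum_mem fun s _ => Submodule.smul_mem _ _ (R.w_smul_mem_nilpFilt _ _ hm)))

/-- A module generated by vectors killed by `h` is locally nilpotent. -/
theorem exists_mem_nilpFilt {X : Set M} (hX : Submodule.span R.H X = ⊤)
    (hy : ∀ m ∈ X, ∀ v, R.y v • m = 0) (m : M) : ∃ n, m ∈ R.nilpFilt M n := by
  have hmem (m : M) : m ∈ ⨆ n, R.nilpFilt M n ↔ ∃ n, m ∈ R.nilpFilt M n :=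
    Submodule.mem_iSup_of_directed _ R.nilpFilt_mono.directed_le
  rw [← hmem, R.eq_top_of_stable (⨆ n, R.nilpFilt M n) (fun a m hm => ?_) (fun v m hm => ?_)
    (fun g m hm => ?_) hX (fun m hm => (hmem m).mpr ⟨1, R.mem_nilpFilt_succ.mpr (hy m hm)⟩)]
  · trivial
  all_goals
    rw [hmem] at hm ⊢
    obtain ⟨n, hn⟩ := hm
  · exact ⟨n + 1, R.x_smul_mem_nilpFilt n a hn⟩
  · exact ⟨n, R.mem_nilpFilt_succ.mp (R.nilpFilt_le_succ n hn) v⟩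
  · exact ⟨n, R.w_smul_mem_nilpFilt n g hn⟩

/-! ### The Euler element -/

variable [FiniteDimensional ℂ V]

/-- The Euler element, up to an additive constant. -/
def euler : R.H :=
  ∑ i, R.x ((finBasis ℂ V).coord i) * R.y (finBasis ℂ V i) - ∑ s : G.Refl, D.coeff c s • R.w s.1

theorem euler_mul_x (a : Dual ℂ V) : R.euler * R.x a = R.x a * R.euler + R.x a := by
  set b := finBasis ℂ V
  have h1 : ∑ i, R.x (b.coord i) * (R.y (b i) * R.x a - R.x a * R.y (b i)) =
      R.x a - ∑ s : G.Refl, D.coeff c s •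
        (R.x (a - a ∘ₗ (s.1 : V ≃ₗ[ℂ] V).symm.toLinearMap) * R.w s.1) := by
    have hsum (f : Dual ℂ V) : ∑ i, f (b i) • R.x (b.coord i) = R.x f := by
      simp_rw [← map_smul, ← map_sum, b.sum_dual_apply_smul_coord]
    simp only [rel_sum, mul_sub, Finset.sum_sub_distrib, Finset.mul_sum]
    congr 1
    · rw [← hsum a]
      refine Finset.sum_congr rfl fun i _ => ?_
      rw [← Algebra.commutes, ← Algebra.smul_def]
    · rw [Finset.sum_comm]
      refine Finset.sum_congr rfl fun s _ => ?_
      rw [← hsum, Finset.sum_mul, Finset.smul_sum]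
      refine Finset.sum_congr rfl fun i _ => ?_
      simp [smul_smul, mul_sub]
  have h2 : (∑ s : G.Refl, D.coeff c s • R.w s.1) * R.x a =
      ∑ s : G.Refl, D.coeff c s • (R.x (a ∘ₗ (s.1 : V ≃ₗ[ℂ] V).symm.toLinearMap) * R.w s.1) := by
    rw [Finset.sum_mul]
    refine Finset.sum_congr rfl fun s _ => ?_
    rw [smul_mul_assoc, R.w_x]
    rfl
  have h3 : R.x a * ∑ s : G.Refl, D.coeff c s • R.w s.1 =
      ∑ s : G.Refl, D.coeff c s • (R.x a * R.w s.1) := by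
    simp [Finset.mul_sum]
  have h4 : ∑ i, R.x (b.coord i) * (R.y (b i) * R.x a - R.x a * R.y (b i)) =
      (∑ i, R.x (b.coord i) * R.y (b i)) * R.x a -
        R.x a * ∑ i, R.x (b.coord i) * R.y (b i) := by
    rw [Finset.sum_mul, Finset.mul_sum, ← Finset.sum_sub_distrib]
    refine Finset.sum_congr rfl fun i _ => ?_
    rw [mul_sub, ← mul_assoc, ← mul_assoc, ← mul_assoc, R.comm_x a]
  have h5 := h4.symm.trans h1
  simp only [map_sub, sub_mul, smul_sub, Finset.sum_sub_distrib] at h5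
  rw [euler, sub_mul, mul_sub, h2, h3, sub_eq_iff_eq_add.mp h5]
  abel

variable (M) in
/-- The eigenspace of the Euler element for the eigenvalue `h + n`. -/
def weightSpace (h : ℂ) (n : ℕ) : Submodule ℂ M :=
  End.eigenspace (Algebra.lsmul ℂ ℂ M R.euler) (h + n)

theorem mem_weightSpace {h : ℂ} {n : ℕ} {m : M} :
    m ∈ R.weightSpace M h n ↔ R.euler • m = (h + n) • m :=
  End.mem_eigenspace_iff

theorem x_smul_mem_weightSpace {h : ℂ} {n : ℕ} {m : M} (hm : m ∈ R.weightSpace M h n)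
    (a : Dual ℂ V) : R.x a • m ∈ R.weightSpace M h (n + 1) := by
  rw [mem_weightSpace] at hm ⊢
  rw [← mul_smul, euler_mul_x, add_smul, mul_smul, hm, smul_comm]
  rw [Nat.cast_succ, ← add_assoc, add_smul _ (1 : ℂ), one_smul]

theorem map_mem_weightSpace {N : Type} [AddCommGroup N] [Module ℂ N] [Module R.H N]
    [IsScalarTower ℂ R.H N] (f : M →ₗ[R.H] N) {h : ℂ} {n : ℕ} {m : M}
    (hm : m ∈ R.weightSpace M h n) : f m ∈ R.weightSpace N h n := by
  rw [mem_weightSpace] at hm ⊢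
  rw [← map_smul, hm]
  exact (f.restrictScalars ℂ).map_smul _ _

variable (M) in
/-- The sum of all eigenspaces of the Euler element for `h + n` with `n > 0`. -/
def positivePart (h : ℂ) : Submodule ℂ M := ⨆ n, R.weightSpace M h (n + 1)

theorem map_mem_positivePart {N : Type} [AddCommGroup N] [Module ℂ N] [Module R.H N]
    [IsScalarTower ℂ R.H N] (f : M →ₗ[R.H] N) {h : ℂ} {m : M}
    (hm : m ∈ R.positivePart M h) : f m ∈ R.positivePart N h := by
  have : R.positivePart M h ≤ (R.positivePart N h).comap (f.restrictScalars ℂ) :=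
    iSup_le fun n m hm => Submodule.mem_iSup_of_mem n (R.map_mem_weightSpace f hm)
  exact this hm

theorem disjoint_positivePart (h : ℂ) :
    Disjoint (R.weightSpace M h 0) (R.positivePart M h) := by
  have hinj : Function.Injective fun n : ℕ => h + n := fun m n hmn => by simpa using hmn
  refine (((End.eigenspaces_iSupIndep _).comp hinj) 0).mono_right (iSup_le fun n => ?_)
  exact le_iSup₂_of_le (f := fun j (_ : j ≠ 0) => R.weightSpace M h j) (n + 1) n.succ_ne_zero le_rfl

theorem eq_zero_of_mem {h : ℂ} {m : M} (h0 : m ∈ R.weightSpace M h 0)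
    (hp : m ∈ R.positivePart M h) : m = 0 :=
  Submodule.disjoint_def.mp (R.disjoint_positivePart h) m h0 hp

end Modules

end RCA

/-- `j : τ → M` exhibits `M` as a lowest weight module with lowest weight `τ`. -/
structure IsLowestWeight (R : RCA G D c) (τ : WRep G) {M : Type} [AddCommGroup M] [Module ℂ M]
    [Module R.H M] (j : τ.T →ₗ[ℂ] M) : Prop where
  y_smul : ∀ v t, R.y v • j t = 0
  w_smul : ∀ g t, R.w g • j t = j (τ.ρ g t)
  span_range : Submodule.span R.H (Set.range j) = ⊤

namespace IsLowestWeight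

variable {R : RCA G D c} {τ : WRep G} {M : Type} [AddCommGroup M] [Module ℂ M]
    [Module R.H M] {j : τ.T →ₗ[ℂ] M}

theorem injective (hj : IsLowestWeight R τ j) (hτ : τ.IsIrr) (h0 : j ≠ 0) :
    Function.Injective j := by
  rw [← LinearMap.ker_eq_bot]
  refine (hτ.2 _ fun g t ht => ?_).resolve_right fun h => h0 (LinearMap.ker_eq_top.mp h)
  rw [LinearMap.mem_ker] at ht ⊢
  rw [← hj.w_smul, ht, smul_zero]

theorem ne_zero [Nontrivial M] (hj : IsLowestWeight R τ j) : j ≠ 0 := by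
  rintro rfl
  have h := hj.span_range
  rw [Submodule.span_eq_bot.mpr (by rintro _ ⟨t, rfl⟩; rfl)] at h
  exact bot_ne_top h

variable [IsScalarTower ℂ R.H M]

theorem quotient (hj : IsLowestWeight R τ j) (N : Submodule R.H M) :
    IsLowestWeight R τ (N.mkQ.restrictScalars ℂ ∘ₗ j) where
  y_smul v t := by
    simp only [LinearMap.comp_apply, LinearMap.restrictScalars_apply]
    rw [← map_smul, hj.y_smul, map_zero]
  w_smul g t := by
    simp only [LinearMap.comp_apply, LinearMap.restrictScalars_apply]
    rw [← map_smul, hj.w_smul]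
  span_range := by
    have : ⇑(N.mkQ.restrictScalars ℂ ∘ₗ j) = N.mkQ ∘ j := rfl
    rw [this, Set.range_comp, ← Submodule.map_span, hj.span_range, Submodule.map_top,
      Submodule.range_mkQ]

variable [FiniteDimensional ℂ V]

theorem exists_weight (hj : IsLowestWeight R τ j) (hτ : τ.IsIrr) (hc : IsConjInvariant c) :
    ∃ h, ∀ t, j t ∈ R.weightSpace M h 0 := by
  obtain ⟨h, hh⟩ := hτ.exists_scalar D hc
  refine ⟨-h, fun t => ?_⟩
  rw [R.mem_weightSpace, RCA.euler, sub_smul, Finset.sum_smul, Finset.sum_smul]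
  simp only [mul_smul, hj.y_smul, smul_zero, Finset.sum_const_zero, smul_assoc, hj.w_smul,
    zero_sub]
  have ht := congrArg j (hh t)
  simp only [map_sum, map_smul] at ht
  rw [ht, Nat.cast_zero, add_zero, neg_smul]

theorem range_sup_positivePart (hj : IsLowestWeight R τ j) {h : ℂ}
    (hh : ∀ t, j t ∈ R.weightSpace M h 0) : LinearMap.range j ⊔ R.positivePart M h = ⊤ := by
  let F : ℕ → Submodule ℂ M := fun n => n.rec (LinearMap.range j) fun _ S =>
    ⨆ a, S.map (Algebra.lsmul ℂ ℂ M (R.x a))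
  have hF0 : F 0 = LinearMap.range j := rfl
  have hFs (n : ℕ) : F (n + 1) = ⨆ a, (F n).map (Algebra.lsmul ℂ ℂ M (R.x a)) := rfl
  have hFx {n : ℕ} {m : M} (hm : m ∈ F n) (a : Dual ℂ V) : R.x a • m ∈ F (n + 1) :=
    Submodule.mem_iSup_of_mem a ⟨m, hm, rfl⟩
  have hFind {n : ℕ} {S : Submodule ℂ M} (h : ∀ a, ∀ m ∈ F n, R.x a • m ∈ S) : F (n + 1) ≤ S :=
    iSup_le fun a => Submodule.map_le_iff_le_comap.mpr (h a)
  have hFw (n : ℕ) (g : G.W) : F n ≤ (F n).comap (Algebra.lsmul ℂ ℂ M (R.w g)) := by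
    induction n with
    | zero =>
      rintro _ ⟨t, rfl⟩
      exact ⟨τ.ρ g t, (hj.w_smul g t).symm⟩
    | succ n ih =>
      refine hFind fun a m hm => ?_
      simp only [Submodule.mem_comap, Algebra.lsmul_coe]
      rw [← mul_smul, R.w_x, mul_smul]
      exact hFx (ih hm) _
  have hle (n : ℕ) : F n ≤ ⨆ n, F n := le_iSup F n
  have hSx (a : Dual ℂ V) : (⨆ n, F n) ≤ (⨆ n, F n).comap (Algebra.lsmul ℂ ℂ M (R.x a)) :=
    iSup_le fun n m hm => hle (n + 1) (hFx hm a)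
  have hSw (g : G.W) : (⨆ n, F n) ≤ (⨆ n, F n).comap (Algebra.lsmul ℂ ℂ M (R.w g)) :=
    iSup_le fun n m hm => hle n (hFw n g hm)
  have hSy (v : V) : (⨆ n, F n) ≤ (⨆ n, F n).comap (Algebra.lsmul ℂ ℂ M (R.y v)) := by
    refine iSup_le fun n => ?_
    induction n with
    | zero =>
      rintro _ ⟨t, rfl⟩
      simp [hj.y_smul]
    | succ n ih =>
      refine hFind fun a m hm => ?_
      simp only [Submodule.mem_comap, Algebra.lsmul_coe]
      rw [R.y_smul_x_smul]
      exact add_mem (hSx a (ih hm)) (sub_mem (Submodule.smul_mem _ _ (hle n hm))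
        (sum_mem fun s _ => Submodule.smul_mem _ _ (hSw _ (hle n hm))))
  rw [eq_top_iff, ← R.eq_top_of_stable (⨆ n, F n) hSx hSy hSw hj.span_range
    (by rintro _ ⟨t, rfl⟩; exact hle 0 ⟨t, rfl⟩)]
  have hFE (n : ℕ) : F n ≤ R.weightSpace M h n := by
    induction n with
    | zero =>
      rintro _ ⟨t, rfl⟩
      exact hh t
    | succ n ih => exact hFind fun a m hm => R.x_smul_mem_weightSpace (ih hm) a
  refine iSup_le fun n => ?_
  cases n with
  | zero => exact le_sup_left
  | succ n => exact le_sup_of_le_right ((hFE _).trans (le_iSup (fun n => R.weightSpace M h (n + 1)) n))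

theorem exists_decomposition (hj : IsLowestWeight R τ j) {h : ℂ}
    (hh : ∀ t, j t ∈ R.weightSpace M h 0) (m : M) : ∃ t, m - j t ∈ R.positivePart M h := by
  have hm : m ∈ LinearMap.range j ⊔ R.positivePart M h := by
    rw [hj.range_sup_positivePart hh]
    trivial
  obtain ⟨_, ⟨t, rfl⟩, p, hp, rfl⟩ := Submodule.mem_sup.mp hm
  exact ⟨t, by simpa using hp⟩

theorem mem_range_of_mem_weightSpace (hj : IsLowestWeight R τ j) {h : ℂ}
    (hh : ∀ t, j t ∈ R.weightSpace M h 0) {m : M} (hm : m ∈ R.weightSpace M h 0) :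
    m ∈ LinearMap.range j := by
  obtain ⟨t, ht⟩ := hj.exists_decomposition hh m
  exact ⟨t, (sub_eq_zero.mp (R.eq_zero_of_mem (sub_mem hm (hh t)) ht)).symm⟩

/-- Every eigenvalue of the Euler element lies in `h + ℕ`. -/
theorem exists_eq_add_natCast (hj : IsLowestWeight R τ j) {h h' : ℂ}
    (hh : ∀ t, j t ∈ R.weightSpace M h 0) {m : M} (hm : m ∈ R.weightSpace M h' 0) (hm0 : m ≠ 0) :
    ∃ n : ℕ, h' = h + n := by
  by_contra! hne
  have hle : R.weightSpace M h 0 ⊔ R.positivePart M h ≤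
      ⨆ (μ) (_ : μ ≠ h' + (0 : ℕ)), End.eigenspace (Algebra.lsmul ℂ ℂ M R.euler) μ := by
    have (n : ℕ) : R.weightSpace M h n ≤
        ⨆ (μ) (_ : μ ≠ h' + (0 : ℕ)), End.eigenspace (Algebra.lsmul ℂ ℂ M R.euler) μ :=
      le_iSup₂_of_le (h + n) (by simpa using (hne n).symm) le_rfl
    exact sup_le (this 0) (iSup_le fun n => this _)
  have hrange : LinearMap.range j ≤ R.weightSpace M h 0 := by
    rintro _ ⟨t, rfl⟩
    exact hh t
  have htop := (sup_le_sup_right hrange _).trans hle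
  rw [hj.range_sup_positivePart hh] at htop
  exact hm0 (Submodule.disjoint_def.mp (End.eigenspaces_iSupIndep _ _) m hm (htop trivial))

theorem le_positivePart (hj : IsLowestWeight R τ j) (hτ : τ.IsIrr) {h : ℂ}
    (hh : ∀ t, j t ∈ R.weightSpace M h 0) {N : Submodule R.H M} (hN : N ≠ ⊤) :
    N.restrictScalars ℂ ≤ R.positivePart M h := by
  intro m hm
  obtain ⟨t, ht⟩ := hj.exists_decomposition hh m
  have hjN := hj.quotient N
  have : Nontrivial (M ⧸ N) := Submodule.Quotient.nontrivial_iff.mpr hN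
  have h0 : N.mkQ (j t) = 0 := by
    refine R.eq_zero_of_mem (R.map_mem_weightSpace N.mkQ (hh t)) ?_
    have hmq : N.mkQ m = 0 := (Submodule.Quotient.mk_eq_zero N).mpr hm
    have := neg_mem (R.map_mem_positivePart N.mkQ ht)
    rwa [map_sub, hmq, zero_sub, neg_neg] at this
  have ht0 : t = 0 := hjN.injective hτ hjN.ne_zero (by simpa using h0)
  simpa [ht0] using ht

theorem existsUnique_isGreatestProper [Nontrivial M] (hj : IsLowestWeight R τ j) (hτ : τ.IsIrr)
    (hc : IsConjInvariant c) : ∃! N : Submodule R.H M, IsGreatestProper N := by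
  obtain ⟨h, hh⟩ := hj.exists_weight hτ hc
  let J : Submodule R.H M :=
    { carrier := {m | ∀ r : R.H, r • m ∈ R.positivePart M h}
      add_mem' := fun ha hb r => by rw [smul_add]; exact add_mem (ha r) (hb r)
      zero_mem' := fun r => by rw [smul_zero]; exact zero_mem _
      smul_mem' := fun s m hm r => by rw [← mul_smul]; exact hm _ }
  refine ⟨J, ⟨fun hJ => ?_, fun N hN m hm r => ?_⟩,
    fun N hN => ?_⟩
  · refine hj.ne_zero (LinearMap.ext fun t => R.eq_zero_of_mem (hh t) ?_)
    have ht : j t ∈ J := hJ ▸ trivial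
    simpa using ht 1
  · exact hj.le_positivePart hτ hh hN (N.smul_mem r hm)
  · refine le_antisymm (fun m hm r => hj.le_positivePart hτ hh hN.1 (N.smul_mem r hm))
      (hN.2 J fun hJ => ?_)
    refine hj.ne_zero (LinearMap.ext fun t => R.eq_zero_of_mem (hh t) ?_)
    have ht : j t ∈ J := hJ ▸ trivial
    simpa using ht 1

/-- Isomorphic nonzero lowest weight modules have isomorphic lowest weights. -/
theorem iso_of_linearEquiv [Nontrivial M] (hj : IsLowestWeight R τ j) (hτ : τ.IsIrr)
    (hc : IsConjInvariant c) {τ' : WRep G} {M' : Type} [AddCommGroup M'] [Module ℂ M']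
    [Module R.H M'] [IsScalarTower ℂ R.H M'] {j' : τ'.T →ₗ[ℂ] M'} (hj' : IsLowestWeight R τ' j')
    (hτ' : τ'.IsIrr) (e : M ≃ₗ[R.H] M') : τ.Iso τ' := by
  have : Nontrivial M' := e.symm.toEquiv.nontrivial
  obtain ⟨h, hh⟩ := hj.exists_weight hτ hc
  obtain ⟨h', hh'⟩ := hj'.exists_weight hτ' hc
  have hinj := hj.injective hτ hj.ne_zero
  have hinj' := hj'.injective hτ' hj'.ne_zero
  have := hτ.1
  have := hτ'.1
  obtain ⟨t, ht⟩ := exists_ne (0 : τ.T)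
  obtain ⟨t', ht'⟩ := exists_ne (0 : τ'.T)
  obtain ⟨n, hn⟩ := hj'.exists_eq_add_natCast hh' (R.map_mem_weightSpace e.toLinearMap (hh t))
    (by simpa using (map_ne_zero_iff j hinj).mpr ht)
  obtain ⟨n', hn'⟩ := hj.exists_eq_add_natCast hh
    (R.map_mem_weightSpace e.symm.toLinearMap (hh' t'))
    (by simpa using (map_ne_zero_iff j' hinj').mpr ht')
  have hnn : (n + n' : ℂ) = 0 := by linear_combination -hn - hn'
  have hn0 : n = 0 := by
    norm_cast at hnn
    omega
  obtain rfl : h = h' := by simpa [hn0] using hn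
  have hmem (t : τ.T) : e (j t) ∈ LinearMap.range j' :=
    hj'.mem_range_of_mem_weightSpace hh' (R.map_mem_weightSpace e.toLinearMap (hh t))
  let f : τ.T →ₗ[ℂ] τ'.T := (LinearEquiv.ofInjective j' hinj').symm.toLinearMap ∘ₗ
    ((e.toLinearMap.restrictScalars ℂ ∘ₗ j).codRestrict (LinearMap.range j') hmem)
  have hf (t : τ.T) : j' (f t) = e (j t) :=
    congrArg Subtype.val ((LinearEquiv.ofInjective j' hinj').apply_symm_apply ⟨e (j t), hmem t⟩)
  have hfw (g : G.W) (t : τ.T) : f (τ.ρ g t) = τ'.ρ g (f t) := by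
    apply hinj'
    rw [hf, ← hj.w_smul, map_smul, ← hf, hj'.w_smul]
  have hfinj : Function.Injective f := by
    intro t₁ t₂ h12
    apply hinj
    apply e.injective
    rw [← hf, ← hf, h12]
  have hfsurj : Function.Surjective f := by
    rw [← LinearMap.range_eq_top]
    refine (hτ'.2 _ ?_).resolve_left fun h0 => ?_
    · rintro g _ ⟨t, rfl⟩
      exact ⟨τ.ρ g t, hfw g t⟩
    · rw [LinearMap.range_eq_bot] at h0
      exact ht (hfinj (by simp [h0]))
  exact ⟨LinearEquiv.ofBijective f ⟨hfinj, hfsurj⟩, hfw⟩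

end IsLowestWeight

end
end LowestWeight

section GreatestProper

variable {A : Type} [Ring A] {M : Type} [AddCommGroup M] [Module A M] {N : Submodule A M}

theorem IsGreatestProper.isCoatom (hN : IsGreatestProper N) : IsCoatom N := by
  refine ⟨hN.1, fun N' hN' => ?_⟩
  by_contra h
  exact hN'.not_ge (hN.2 N' h)

theorem IsGreatestProper.eq_of_isCoatom (hN : IsGreatestProper N) {N' : Submodule A M}
    (hN' : IsCoatom N') : N' = N :=
  ((hN'.le_iff.mp (hN.2 N' hN'.1)).resolve_left hN.1).symm

end GreatestProper

section Verma
noncomputable section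

open Module

variable {V : Type} [AddCommGroup V] [Module ℂ V]
variable {G : CRG V} {D : ReflData G} {c : G.Refl → ℂ}

/-- The complex vector space underlying a module over the rational Cherednik algebra. -/
abbrev RCA.complexModule (R : RCA G D c) (M : Type) [AddCommGroup M] [Module R.H M] :
    Module ℂ M :=
  Module.compHom M (algebraMap ℂ R.H)

theorem RCA.isScalarTower_complexModule (R : RCA G D c) (M : Type) [AddCommGroup M]
    [Module R.H M] :
    letI := R.complexModule M
    IsScalarTower ℂ R.H M :=
  letI := R.complexModule M
  IsScalarTower.of_algebraMap_smul fun _ _ => rfl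

namespace VermaStr

variable {R : RCA G D c} {τ : WRep G} {M : Type} [AddCommGroup M] [Module R.H M]

theorem span_range (S : VermaStr R τ M) : Submodule.span R.H (Set.range S.ι) = ⊤ := by
  set N := Submodule.span R.H (Set.range S.ι)
  have h := (S.universal (M ⧸ N) 0 (fun a t => by simp) (fun v t => by simp)
    (fun g t => by simp)).unique (y₁ := N.mkQ) (y₂ := 0)
    (fun t => (Submodule.Quotient.mk_eq_zero N).mpr (Submodule.subset_span ⟨t, rfl⟩))
    (fun t => rfl)
  rw [← N.ker_mkQ, h, LinearMap.ker_zero]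

/-- The inclusion of the lowest weight, as a `ℂ`-linear map. -/
def lowestWeight (S : VermaStr R τ M) :
    letI := R.complexModule M
    τ.T →ₗ[ℂ] M :=
  letI := R.complexModule M
  { S.ι with map_smul' := S.ι_smul }

theorem isLowestWeight (S : VermaStr R τ M) :
    letI := R.complexModule M
    IsLowestWeight R τ S.lowestWeight :=
  letI := R.complexModule M
  { y_smul := S.ι_y
    w_smul := S.ι_w
    span_range := S.span_range }

theorem nontrivial [FiniteDimensional ℂ V] (S : VermaStr R τ M) (hc : IsConjInvariant c)
    (hτ : τ.IsIrr) : Nontrivial M := by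
  obtain ⟨φ, -, hφy, hφw⟩ := exists_dunkl_rep D hc R
  let : Module R.H (DunklSpace G) := Module.compHom (DunklSpace G) φ.toRingHom
  have hsmul (r : R.H) (F : DunklSpace G) : r • F = φ r F := rfl
  have := hτ.1
  obtain ⟨t, ht⟩ := exists_ne (0 : τ.T)
  obtain ⟨ℓ, hℓ⟩ : ∃ ℓ : Dual ℂ τ.T, ℓ t ≠ 0 := by
    by_contra! h
    exact ht ((forall_dual_apply_eq_zero_iff ℂ t).mp h)
  let κ : τ.T →+ DunklSpace G :=
    { toFun := fun t => dunklConst fun h => ℓ (τ.ρ h⁻¹ t)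
      map_zero' := by funext h; simp [dunklConst]
      map_add' := fun t u => by funext h; simp [dunklConst] }
  have hκ (t : τ.T) : κ t = dunklConst fun h => ℓ (τ.ρ h⁻¹ t) := rfl
  obtain ⟨f, hf, -⟩ := S.universal (DunklSpace G) κ
    (fun a t => by
      funext h
      rw [hsmul, AlgHom.commutes, Module.algebraMap_end_apply, hκ, hκ]
      simp [dunklConst, MvPolynomial.smul_eq_C_mul])
    (fun v t => by rw [hsmul, hφy, hκ, dunklY_const])
    (fun g t => by
      rw [hsmul, hφw, hκ, hκ, dunklW_const]
      congr 1
      funext h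
      rw [← LinearEquiv.mul_apply, ← map_mul, mul_inv_rev, inv_inv])
  refine ⟨S.ι t, 0, fun h0 => hℓ ?_⟩
  have h := congrFun (hf t) 1
  rw [h0, map_zero, hκ] at h
  exact MvPolynomial.C_injective _ ℂ (by simpa [dunklConst, eq_comm] using h)

end VermaStr

/-- The relations defining `H_c ⊗_{S(h)#W} τ` inside the free `H_c`-module on the set `τ`. -/
def vermaRel (R : RCA G D c) (τ : WRep G) : Submodule R.H (τ.T →₀ R.H) :=
  Submodule.span R.H
    ({m | ∃ t u, m = .single (t + u) 1 - (.single t 1 + .single u 1)} ∪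
      {m | ∃ (a : ℂ) (t : τ.T), m = .single (a • t) 1 - .single t (algebraMap ℂ R.H a)} ∪
      {m | ∃ v t, m = .single t (R.y v)} ∪
      {m | ∃ g t, m = .single (τ.ρ g t) 1 - .single t (R.w g)})

/-- The Verma module `H_c ⊗_{S(h)#W} τ`. -/
abbrev VermaModule (R : RCA G D c) (τ : WRep G) : Type := (τ.T →₀ R.H) ⧸ vermaRel R τ

theorem VermaModule.mk_eq_zero (R : RCA G D c) (τ : WRep G) {m : τ.T →₀ R.H}
    (h : m ∈ ({m | ∃ t u, m = .single (t + u) 1 - (.single t 1 + .single u 1)} ∪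
      {m | ∃ (a : ℂ) (t : τ.T), m = .single (a • t) 1 - .single t (algebraMap ℂ R.H a)} ∪
      {m | ∃ v t, m = .single t (R.y v)} ∪
      {m | ∃ g t, m = .single (τ.ρ g t) 1 - .single t (R.w g)} : Set (τ.T →₀ R.H))) :
    (vermaRel R τ).mkQ m = 0 :=
  (Submodule.Quotient.mk_eq_zero _).mpr (Submodule.subset_span h)

/-- The universal property of the Verma module. -/
def vermaModuleStr (R : RCA G D c) (τ : WRep G) : VermaStr R τ (VermaModule R τ) where
  ι := AddMonoidHom.mk' (fun t => (vermaRel R τ).mkQ (.single t 1)) fun t u => by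
    rw [← sub_eq_zero, ← map_add, ← map_sub]
    exact VermaModule.mk_eq_zero R τ (.inl (.inl (.inl ⟨t, u, rfl⟩)))
  ι_smul a t := by
    simp only [AddMonoidHom.mk'_apply]
    rw [← map_smul, ← sub_eq_zero, ← map_sub, Finsupp.smul_single, smul_eq_mul, mul_one]
    exact VermaModule.mk_eq_zero R τ (.inl (.inl (.inr ⟨a, t, rfl⟩)))
  ι_y v t := by
    simp only [AddMonoidHom.mk'_apply]
    rw [← map_smul, Finsupp.smul_single, smul_eq_mul, mul_one]
    exact VermaModule.mk_eq_zero R τ (.inl (.inr ⟨v, t, rfl⟩))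
  ι_w g t := by
    simp only [AddMonoidHom.mk'_apply]
    symm
    rw [← map_smul, ← sub_eq_zero, ← map_sub, Finsupp.smul_single, smul_eq_mul, mul_one]
    exact VermaModule.mk_eq_zero R τ (.inr ⟨g, t, rfl⟩)
  universal N _ _ κ hsmul hy hw := by
    have hle : vermaRel R τ ≤ LinearMap.ker (Finsupp.linearCombination R.H κ) := by
      refine Submodule.span_le.mpr ?_
      rintro _ (((⟨t, u, rfl⟩ | ⟨a, t, rfl⟩) | ⟨v, t, rfl⟩) | ⟨g, t, rfl⟩)
      · simp
      · simp [hsmul]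
      · simp [hy]
      · simp [hw]
    refine ⟨(vermaRel R τ).liftQ _ hle, fun t => ?_, fun φ hφ => ?_⟩
    · simp
    · refine Submodule.linearMap_qext _ (Finsupp.lhom_ext' fun t => LinearMap.ext_ring ?_)
      simpa using hφ t

/-- The Verma module, as an object of category `𝒪`. -/
def vermaCatO (R : RCA G D c) (τ : WRep G) : CatO R where
  M := VermaModule R τ
  locNilp m := by
    let := R.complexModule (VermaModule R τ)
    have := R.isScalarTower_complexModule (VermaModule R τ)
    obtain ⟨n, hn⟩ := R.exists_mem_nilpFilt (vermaModuleStr R τ).span_range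
      (by rintro _ ⟨t, rfl⟩ v; exact (vermaModuleStr R τ).ι_y v t) m
    exact ⟨n, R.mem_nilpFilt_iff.mp hn⟩
  fg := by
    let := R.complexModule (VermaModule R τ)
    have := R.isScalarTower_complexModule (VermaModule R τ)
    let j := (vermaModuleStr R τ).lowestWeight
    have hj := (vermaModuleStr R τ).isLowestWeight
    obtain ⟨s, hs⟩ := Module.Finite.fg_top (R := ℂ) (M := τ.T)
    classical
    refine ⟨s.image j, eq_top_iff.mpr ?_⟩
    rw [← hj.span_range]
    refine Submodule.span_le.mpr ?_
    rintro _ ⟨t, rfl⟩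
    have ht : t ∈ Submodule.span ℂ (s : Set τ.T) := hs ▸ trivial
    have hle : Submodule.span ℂ (s : Set τ.T) ≤
        ((Submodule.span R.H (s.image j : Set (VermaModule R τ))).restrictScalars ℂ).comap j :=
      Submodule.span_le.mpr fun u hu =>
        Submodule.subset_span (by simpa using ⟨u, hu, rfl⟩)
    exact hle ht

/-- A nonzero object of category `𝒪` contains an irreducible representation of `W` killed by `h`. -/
theorem CatO.exists_irr {R : RCA G D c} (B : CatO R) [Nontrivial B.M] :
    letI := R.complexModule B.M
    ∃ τ : WRep G, τ.IsIrr ∧ ∃ j : τ.T →ₗ[ℂ] B.M, Function.Injective j ∧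
      (∀ v t, R.y v • j t = 0) ∧ ∀ g t, R.w g • j t = j (τ.ρ g t) := by
  let := R.complexModule B.M
  have := R.isScalarTower_complexModule B.M
  have hsing : ∃ b ∈ R.nilpFilt B.M 1, b ≠ 0 := by
    obtain ⟨b, hb⟩ := exists_ne (0 : B.M)
    obtain ⟨n, hn⟩ := B.locNilp b
    rw [← R.mem_nilpFilt_iff] at hn
    by_contra! h
    have hbot (n : ℕ) : R.nilpFilt B.M n = ⊥ := by
      induction n with
      | zero => rfl
      | succ n ih =>
        refine eq_bot_iff.mpr fun m hm => h m (R.mem_nilpFilt_succ.mpr fun v => ?_)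
        have := R.mem_nilpFilt_succ.mp hm v
        rwa [ih] at this
    rw [hbot] at hn
    exact hb hn
  obtain ⟨b, hb, hb0⟩ := hsing
  let P : Submodule ℂ B.M → Prop := fun U => FiniteDimensional ℂ U ∧ U ≠ ⊥ ∧
    U ≤ R.nilpFilt B.M 1 ∧ ∀ g, ∀ m ∈ U, R.w g • m ∈ U
  have hP : ∃ U, P U := by
    refine ⟨Submodule.span ℂ (Set.range fun g => R.w g • b),
      FiniteDimensional.span_of_finite ℂ (Set.finite_range _), fun h => hb0 ?_,
      Submodule.span_le.mpr ?_, fun g m hm => ?_⟩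
    · have : b ∈ Submodule.span ℂ (Set.range fun g => R.w g • b) :=
        Submodule.subset_span ⟨1, by simp⟩
      rwa [h] at this
    · rintro _ ⟨g, rfl⟩
      exact R.w_smul_mem_nilpFilt 1 g hb
    · have hle : Submodule.span ℂ (Set.range fun g => R.w g • b) ≤
          (Submodule.span ℂ (Set.range fun g => R.w g • b)).comap
            (Algebra.lsmul ℂ ℂ B.M (R.w g)) := by
        refine Submodule.span_le.mpr ?_
        rintro _ ⟨g', rfl⟩
        exact Submodule.subset_span ⟨g * g', by simp [mul_smul]⟩
      exact hle hm
  obtain ⟨U, ⟨hfd, hU0, hUn, hUw⟩, hmin⟩ :=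
    exists_minimalFor_of_wellFoundedLT P (fun U => finrank ℂ U) hP
  let wU (g : G.W) : U →ₗ[ℂ] U := (Algebra.lsmul ℂ ℂ B.M (R.w g)).restrict (hUw g)
  have hwU (g h : G.W) (u : U) : wU g (wU h u) = wU (g * h) u :=
    Subtype.ext <| show R.w g • R.w h • (u : B.M) = R.w (g * h) • (u : B.M) by
      rw [map_mul, mul_smul]
  have hwU1 (u : U) : wU 1 u = u := Subtype.ext (by simp [wU])
  let τ : WRep G :=
    { T := U
      ρ :=
        { toFun := fun g => LinearEquiv.ofLinearMap (wU g) (wU g⁻¹)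
            (LinearMap.ext fun u => by simp [hwU, hwU1])
            (LinearMap.ext fun u => by simp [hwU, hwU1])
          map_one' := LinearEquiv.ext hwU1
          map_mul' := fun g h => LinearEquiv.ext fun u => (hwU g h u).symm } }
  refine ⟨τ, ⟨(Submodule.nontrivial_iff_ne_bot).mpr hU0, fun (S : Submodule ℂ U) hS => ?_⟩,
    U.subtype, U.injective_subtype, fun v t => R.mem_nilpFilt_succ.mp (hUn t.2) v,
    fun g t => rfl⟩
  by_contra! hne
  have hle : finrank ℂ U ≤ finrank ℂ (S.map U.subtype) := by
    refine hmin (j := S.map U.subtype) ⟨inferInstance, fun h => hne.1 ?_,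
      (Submodule.map_subtype_le U S).trans hUn, ?_⟩
      ((Submodule.finrank_mono (Submodule.map_subtype_le U S)))
    · exact Submodule.map_injective_of_injective U.injective_subtype (h.trans (Submodule.map_bot _).symm)
    · rintro g _ ⟨u, hu, rfl⟩
      exact ⟨wU g u, hS g u hu, rfl⟩
  rw [Submodule.finrank_map_subtype_eq] at hle
  exact hne.2 (Submodule.eq_top_of_finrank_eq (le_antisymm (Submodule.finrank_le S) hle))

end
end Verma


variable {V : Type} [AddCommGroup V] [Module ℂ V] [FiniteDimensional ℂ V]
variable {G : CRG V} {D : ReflData G} {c : G.Refl → ℂ}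

/-- **Simple objects of category 𝒪** (Proposition: simples).
Every Verma module `Δ_c(τ)` has a unique simple quotient `L_c(τ)` (equivalently,
a greatest proper submodule `N`, and `Δ_c(τ)/N` is simple), and
`τ ↦ L_c(τ)` is a bijection between `Irr(W)` and the set of isomorphism classes
of simple objects of `𝒪_c(W)`. -/
theorem verma_unique_simple_quotient_and_bijection
    (hc : IsConjInvariant c) (R : RCA G D c) :
    -- existence and uniqueness of the greatest proper submodule of Δ_c(τ)
    (∀ (τ : WRep G), τ.IsIrr → ∀ (Δ : CatO R) (_ : VermaStr R τ Δ.M),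
      ∃! N : Submodule R.H Δ.M, IsGreatestProper N) ∧
    -- the corresponding quotient L_c(τ) is simple
    (∀ (τ : WRep G), τ.IsIrr → ∀ (Δ : CatO R) (_ : VermaStr R τ Δ.M),
      ∀ N : Submodule R.H Δ.M, IsGreatestProper N →
        IsSimpleModule R.H (Δ.M ⧸ N)) ∧
    -- injectivity: L_c(τ) ≅ L_c(τ') implies τ ≅ τ'
    (∀ (τ τ' : WRep G), τ.IsIrr → τ'.IsIrr →
      ∀ (Δ : CatO R) (_ : VermaStr R τ Δ.M) (Δ' : CatO R)
        (_ : VermaStr R τ' Δ'.M)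
        (N : Submodule R.H Δ.M) (N' : Submodule R.H Δ'.M),
        IsGreatestProper N → IsGreatestProper N' →
        Nonempty ((Δ.M ⧸ N) ≃ₗ[R.H] (Δ'.M ⧸ N')) → τ.Iso τ') ∧
    -- surjectivity: every simple object of 𝒪_c(W) is some L_c(τ)
    (∀ B : CatO R, IsSimpleModule R.H B.M →
      ∃ (τ : WRep G), τ.IsIrr ∧
        ∃ (Δ : CatO R) (_ : VermaStr R τ Δ.M) (N : Submodule R.H Δ.M),
          IsGreatestProper N ∧ Nonempty (B.M ≃ₗ[R.H] (Δ.M ⧸ N))) := by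
  refine ⟨fun τ hτ Δ S => ?_, fun τ hτ Δ S N hN => ?_,
    fun τ τ' hτ hτ' Δ S Δ' S' N N' hN hN' ⟨e⟩ => ?_, fun B hB => ?_⟩
  · let := R.complexModule Δ.M
    have := R.isScalarTower_complexModule Δ.M
    have := S.nontrivial hc hτ
    exact S.isLowestWeight.existsUnique_isGreatestProper hτ hc
  · exact isSimpleModule_iff_isCoatom.mpr hN.isCoatom
  · let := R.complexModule Δ.M
    have := R.isScalarTower_complexModule Δ.M
    let := R.complexModule Δ'.M
    have := R.isScalarTower_complexModule Δ'.M
    have : Nontrivial (Δ.M ⧸ N) := Submodule.Quotient.nontrivial_iff.mpr hN.1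
    exact (S.isLowestWeight.quotient N).iso_of_linearEquiv hτ hc (S'.isLowestWeight.quotient N')
      hτ' e
  · have := IsSimpleModule.nontrivial R.H B.M
    let := R.complexModule B.M
    obtain ⟨τ, hτ, j, hj, hjy, hjw⟩ := B.exists_irr
    let Δ := vermaCatO R τ
    let S : VermaStr R τ Δ.M := vermaModuleStr R τ
    let := R.complexModule Δ.M
    have := R.isScalarTower_complexModule Δ.M
    have := S.nontrivial hc hτ
    obtain ⟨N, hN, -⟩ := S.isLowestWeight.existsUnique_isGreatestProper hτ hc
    obtain ⟨φ, hφ, -⟩ := S.universal B.M j.toAddMonoidHom (fun a t => map_smul j a t) hjy hjw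
    have hφ0 : φ ≠ 0 := by
      rintro rfl
      have := hτ.1
      obtain ⟨t, ht⟩ := exists_ne (0 : τ.T)
      exact ht (hj (by simpa using (hφ t).symm))
    have hφs : Function.Surjective φ := LinearMap.surjective_of_ne_zero hφ0
    have e := φ.quotKerEquivOfSurjective hφs
    have hker : LinearMap.ker φ = N := by
      have := IsSimpleModule.congr e
      exact hN.eq_of_isCoatom (isSimpleModule_iff_isCoatom.mp inferInstance)
    exact ⟨τ, hτ, Δ, S, N, hN, ⟨e.symm.trans (Submodule.quotEquivOfEq _ _ hker)⟩⟩

end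
end Stmt3
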